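/- For every nonnegative integer n, G_4(n) - G_5(n) = (-1)^n · K(n), where G_4(n) (resp. G_5(n)) counts the partitions counted by G(n) with an even (resp. odd) total number of parts. -/

import Mathlib

noncomputable section

/-- Overpartitions of `n`: the first component is the set of overlined parts
(at most one overlined part of each size), the second is the multiset of
non-overlined parts; all parts are positive and the total sum is `n`. -/
def overpartitions (n : ℕ) : Set (Finset ℕ × Multiset ℕ) :=
  {p | (∀ x ∈ p.1, 0 < x) ∧ (∀ x ∈ p.2, 0 < x) ∧ p.1.sum id + p.2.sum = n}

/-- `p̄(n)`, the number of overpartitions of `n`. -/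
def pbar (n : ℕ) : ℕ := (overpartitions n).ncard

/-- Overpartitions of `n` into odd parts. -/
def overpartitionsOdd (n : ℕ) : Set (Finset ℕ × Multiset ℕ) :=
  {p | p ∈ overpartitions n ∧ (∀ x ∈ p.1, Odd x) ∧ ∀ x ∈ p.2, Odd x}

/-- `p̄_o(n)`, the number of overpartitions of `n` into odd parts. -/
def pbarOdd (n : ℕ) : ℕ := (overpartitionsOdd n).ncard

/-- Two-color partitions of `n` (first component: blue parts, second: green
parts) in which even parts may occur only in the blue color, i.e. all green
parts are odd. -/
def FSet (n : ℕ) : Set (Multiset ℕ × Multiset ℕ) :=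
  {p | (∀ x ∈ p.1, 0 < x) ∧ (∀ x ∈ p.2, 0 < x) ∧ p.1.sum + p.2.sum = n ∧
    ∀ x ∈ p.2, Odd x}

/-- `F(n)`. -/
def Fcount (n : ℕ) : ℕ := (FSet n).ncard

/-- The number of even parts of a multiset of naturals. -/
def evenParts (m : Multiset ℕ) : ℕ := Multiset.card (m.filter (fun x => Even x))

/-- `F₀(n)`: partitions counted by `F(n)` with an even number of even parts. -/
def F0 (n : ℕ) : ℕ := {p ∈ FSet n | Even (evenParts (p.1 + p.2))}.ncard

/-- `F₁(n)`: partitions counted by `F(n)` with an odd number of even parts. -/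
def F1 (n : ℕ) : ℕ := {p ∈ FSet n | Odd (evenParts (p.1 + p.2))}.ncard

/-- `F₂(n)`: partitions counted by `F(n)` with an even number of parts. -/
def F2 (n : ℕ) : ℕ := {p ∈ FSet n | Even (Multiset.card (p.1 + p.2))}.ncard

/-- `F₃(n)`: partitions counted by `F(n)` with an odd number of parts. -/
def F3 (n : ℕ) : ℕ := {p ∈ FSet n | Odd (Multiset.card (p.1 + p.2))}.ncard

/-- Partitions counted by `F(n)` whose blue parts are distinct odd numbers. -/
def QSet (n : ℕ) : Set (Multiset ℕ × Multiset ℕ) :=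
  {p | p ∈ FSet n ∧ (∀ x ∈ p.1, Odd x) ∧ p.1.Nodup}

/-- `Q(n)`. -/
def Qcount (n : ℕ) : ℕ := (QSet n).ncard

/-- Two-color partitions of `n` (first component: blue parts, second: green
parts) in which odd parts may occur only in the blue color, i.e. all green
parts are even. -/
def GSet (n : ℕ) : Set (Multiset ℕ × Multiset ℕ) :=
  {p | (∀ x ∈ p.1, 0 < x) ∧ (∀ x ∈ p.2, 0 < x) ∧ p.1.sum + p.2.sum = n ∧
    ∀ x ∈ p.2, Even x}

/-- `G(n)`. -/
def Gcount (n : ℕ) : ℕ := (GSet n).ncard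

/-- `G₀(n)`: partitions counted by `G(n)` with an even number of blue even parts. -/
def G0 (n : ℕ) : ℕ := {p ∈ GSet n | Even (evenParts p.1)}.ncard

/-- `G₁(n)`: partitions counted by `G(n)` with an odd number of blue even parts. -/
def G1 (n : ℕ) : ℕ := {p ∈ GSet n | Odd (evenParts p.1)}.ncard

/-- `G₂(n)`: partitions counted by `G(n)` with an even number of blue parts. -/
def G2 (n : ℕ) : ℕ := {p ∈ GSet n | Even (Multiset.card p.1)}.ncard

/-- `G₃(n)`: partitions counted by `G(n)` with an odd number of blue parts. -/
def G3 (n : ℕ) : ℕ := {p ∈ GSet n | Odd (Multiset.card p.1)}.ncard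

/-- `G₄(n)`: partitions counted by `G(n)` with an even total number of parts. -/
def G4 (n : ℕ) : ℕ := {p ∈ GSet n | Even (Multiset.card (p.1 + p.2))}.ncard

/-- `G₅(n)`: partitions counted by `G(n)` with an odd total number of parts. -/
def G5 (n : ℕ) : ℕ := {p ∈ GSet n | Odd (Multiset.card (p.1 + p.2))}.ncard

/-- Partitions of `n` in which the odd parts are distinct. -/
def HSet (n : ℕ) : Set (Multiset ℕ) :=
  {m | (∀ x ∈ m, 0 < x) ∧ m.sum = n ∧ (m.filter (fun x => Odd x)).Nodup}

/-- `H(n)`. -/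
def Hcount (n : ℕ) : ℕ := (HSet n).ncard

/-- Partitions of `n` into distinct parts whose even parts are all
congruent to `2` modulo `4`. -/
def KSet (n : ℕ) : Set (Finset ℕ) :=
  {s | (∀ x ∈ s, 0 < x) ∧ s.sum id = n ∧ ∀ x ∈ s, Even x → x % 4 = 2}

/-- `K(n)`: the signed count of partitions in `KSet n`, each weighted by
`(-1)^j` where `j` is the number of even parts. -/
def Kcount (n : ℕ) : ℤ :=
  ({s ∈ KSet n | Even (s.filter (fun x => Even x)).card}.ncard : ℤ) -
  ({s ∈ KSet n | Odd (s.filter (fun x => Even x)).card}.ncard : ℤ)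

/-- Partitions counted by `G(n)` whose blue parts are distinct odd numbers. -/
def RSet (n : ℕ) : Set (Multiset ℕ × Multiset ℕ) :=
  {p | p ∈ GSet n ∧ (∀ x ∈ p.1, Odd x) ∧ p.1.Nodup}

/-- `R(n)`. -/
def Rcount (n : ℕ) : ℕ := (RSet n).ncard

/-- Two-color partitions of `n` in which all parts of the same color are
distinct and odd parts may occur only in the blue color: the first component
is the (finite) set of blue parts (distinct positive integers), the second the
set of green parts (distinct positive even integers). -/
def LSet (n : ℕ) : Set (Finset ℕ × Finset ℕ) :=
  {p | (∀ x ∈ p.1, 0 < x) ∧ (∀ x ∈ p.2, 0 < x ∧ Even x) ∧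
    p.1.sum id + p.2.sum id = n}

/-- `L₀(n)`: partitions counted by `L(n)` with an even number of blue even parts. -/
def L0 (n : ℕ) : ℕ := {p ∈ LSet n | Even (p.1.filter (fun x => Even x)).card}.ncard

/-- `L₁(n)`: partitions counted by `L(n)` with an odd number of blue even parts. -/
def L1 (n : ℕ) : ℕ := {p ∈ LSet n | Odd (p.1.filter (fun x => Even x)).card}.ncard

/-- `L₂(n)`: partitions counted by `L(n)` with an even number of blue parts. -/
def L2 (n : ℕ) : ℕ := {p ∈ LSet n | Even p.1.card}.ncard

/-- `L₃(n)`: partitions counted by `L(n)` with an odd number of blue parts. -/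
def L3 (n : ℕ) : ℕ := {p ∈ LSet n | Odd p.1.card}.ncard

def Cand (d : ℕ) (m : Multiset ℕ) (x : ℕ) : Prop :=
  0 < x ∧ d ∣ x ∧ (2 * x ∈ m ∨ 2 ≤ m.count x)

def IsMx (d : ℕ) (m : Multiset ℕ) (x : ℕ) : Prop :=
  Cand d m x ∧ ∀ y, Cand d m y → y ≤ x

lemma Cand.le_sum {d x : ℕ} {m : Multiset ℕ} (h : Cand d m x) : x ≤ m.sum := by
  obtain ⟨h0, -, h | h⟩ := h
  · have := Multiset.le_sum_of_mem h
    omega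
  · exact Multiset.le_sum_of_mem (Multiset.count_pos.1 (by omega))

lemma exists_isMx {d : ℕ} {m : Multiset ℕ} (h : ∃ x, Cand d m x) : ∃ x, IsMx d m x := by
  classical
  obtain ⟨x, hx⟩ := h
  refine ⟨Nat.findGreatest (Cand d m) m.sum, Nat.findGreatest_spec hx.le_sum hx, ?_⟩
  intro y hy
  exact Nat.le_findGreatest hy.le_sum hy

lemma IsMx.unique {d x y : ℕ} {m : Multiset ℕ} (h : IsMx d m x) (h' : IsMx d m y) : x = y :=
  le_antisymm (h'.2 _ h.1) (h.2 _ h'.1)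

lemma isMx_swap {d x : ℕ} {t : Multiset ℕ} (hx : 0 < x) (ht : 2 * x ∉ t) :
    IsMx d (2 * x ::ₘ t) x ↔ IsMx d (x ::ₘ x ::ₘ t) x := by
  have hc : t.count (2 * x) = 0 := Multiset.count_eq_zero.2 ht
  have key : ∀ y, x ≤ y → (Cand d (2 * x ::ₘ t) y ↔ Cand d (x ::ₘ x ::ₘ t) y) := by
    intro y hy
    unfold Cand
    simp only [Multiset.mem_cons, Multiset.count_cons]
    rcases eq_or_lt_of_le hy with rfl | hlt
    · simp
    · have h1 : 2 * y ≠ 2 * x := by omega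
      have h2 : 2 * y ≠ x := by omega
      have h3 : y ≠ x := by omega
      by_cases h4 : y = 2 * x
      · subst h4
        simp [h1, h2, h3, hc]
      · simp [h1, h2, h3, h4]
  constructor
  · rintro ⟨h1, h2⟩
    refine ⟨(key x le_rfl).1 h1, fun y hy => ?_⟩
    by_contra hlt
    exact hlt (h2 y ((key y (by omega)).2 hy))
  · rintro ⟨h1, h2⟩
    refine ⟨(key x le_rfl).2 h1, fun y hy => ?_⟩
    by_contra hlt
    exact hlt (h2 y ((key y (by omega)).1 hy))

def stepM (x : ℕ) (m : Multiset ℕ) : Multiset ℕ :=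
  if 2 * x ∈ m then x ::ₘ x ::ₘ m.erase (2 * x) else 2 * x ::ₘ (m.erase x).erase x

open Classical in
def inv (d : ℕ) (m : Multiset ℕ) : Multiset ℕ :=
  if h : ∃ x, IsMx d m x then stepM h.choose m else m

lemma inv_eq {d x : ℕ} {m : Multiset ℕ} (h : IsMx d m x) : inv d m = stepM x m := by
  have h' : ∃ x, IsMx d m x := ⟨x, h⟩
  rw [inv, dif_pos h', h'.choose_spec.unique h]

lemma stepM_a {x : ℕ} {t : Multiset ℕ} : stepM x (2 * x ::ₘ t) = x ::ₘ x ::ₘ t := by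
  simp [stepM]

lemma stepM_b {x : ℕ} {t : Multiset ℕ} (hx : 0 < x) (ht : 2 * x ∉ t) :
    stepM x (x ::ₘ x ::ₘ t) = 2 * x ::ₘ t := by
  have : 2 * x ≠ x := by omega
  simp [stepM, ht, this]

/-- Structure of a multiset with a candidate. -/
lemma cand_cases {d : ℕ} {m : Multiset ℕ} (h : ∃ x, Cand d m x) :
    ∃ x t, 0 < x ∧ d ∣ x ∧ 2 * x ∉ t ∧
      ((m = 2 * x ::ₘ t ∧ inv d m = x ::ₘ x ::ₘ t ∧ IsMx d (inv d m) x) ∨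
        (m = x ::ₘ x ::ₘ t ∧ inv d m = 2 * x ::ₘ t ∧ IsMx d (inv d m) x)) := by
  obtain ⟨x, hx⟩ := exists_isMx h
  have hx0 := hx.1.1
  by_cases hm : 2 * x ∈ m
  · obtain ⟨t, rfl⟩ := Multiset.exists_cons_of_mem hm
    have ht : 2 * x ∉ t := by
      intro ht
      have := hx.2 (2 * x) ⟨by omega, hx.1.2.1.mul_left 2, Or.inr (by
        have := Multiset.count_pos.2 ht
        rw [Multiset.count_cons_self]
        omega)⟩
      omega
    have e : inv d (2 * x ::ₘ t) = x ::ₘ x ::ₘ t := by rw [inv_eq hx, stepM_a]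
    exact ⟨x, t, hx0, hx.1.2.1, ht, Or.inl ⟨rfl, e, by rw [e]; exact (isMx_swap hx0 ht).1 hx⟩⟩
  · have h2 : 2 ≤ m.count x := hx.1.2.2.resolve_left hm
    have h3 : Multiset.replicate 2 x ≤ m := Multiset.le_count_iff_replicate_le.1 h2
    obtain ⟨t, rfl⟩ := Multiset.le_iff_exists_add.1 h3
    have e0 : Multiset.replicate 2 x + t = x ::ₘ x ::ₘ t := by
      simp [Multiset.replicate_succ]
    rw [e0] at hx hm
    rw [e0]
    have ht : 2 * x ∉ t := fun ht => hm (by simp [ht])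
    have e : inv d (x ::ₘ x ::ₘ t) = 2 * x ::ₘ t := by rw [inv_eq hx, stepM_b hx0 ht]
    exact ⟨x, t, hx0, hx.1.2.1, ht, Or.inr ⟨rfl, e, by rw [e]; exact (isMx_swap hx0 ht).2 hx⟩⟩

lemma inv_spec {d : ℕ} {m : Multiset ℕ} (h : ∃ x, Cand d m x) :
    inv d (inv d m) = m ∧ (∃ x, Cand d (inv d m) x) ∧ (inv d m).sum = m.sum ∧
      (-1 : ℤ) ^ (inv d m).card = - (-1) ^ m.card ∧
      ((∀ x ∈ m, 0 < x) → ∀ x ∈ inv d m, 0 < x) ∧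
      ((∀ x ∈ m, d ∣ x) → ∀ x ∈ inv d m, d ∣ x) := by
  obtain ⟨x, t, hx, hd, ht, ⟨rfl, e, hM⟩ | ⟨rfl, e, hM⟩⟩ := cand_cases h
  · refine ⟨?_, ⟨x, hM.1⟩, ?_⟩
    · rw [inv_eq hM, e, stepM_b hx ht]
    · rw [e]
      refine ⟨by simp; ring, by simp; ring, ?_, ?_⟩
      · simp +contextual [hx]
      · simp +contextual [hd]
  · refine ⟨?_, ⟨x, hM.1⟩, ?_⟩
    · rw [inv_eq hM, e, stepM_a]
    · rw [e]
      refine ⟨by simp; ring, by simp; ring, ?_, ?_⟩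
      · simp +contextual [hx]
      · simp +contextual [hd.mul_left]

lemma ncard_sub {α : Type*} {S : Set α} (hS : S.Finite) (c : α → ℕ) :
    (({p ∈ S | Even (c p)}.ncard : ℕ) : ℤ) - ({p ∈ S | Odd (c p)}.ncard : ℕ) =
      ∑ p ∈ hS.toFinset, (-1 : ℤ) ^ c p := by
  classical
  have h1 : {p ∈ S | Even (c p)} = ((hS.toFinset.filter (fun p => Even (c p)) : Finset α) : Set α) := by
    ext; simp
  have h2 : {p ∈ S | Odd (c p)} = ((hS.toFinset.filter (fun p => ¬ Even (c p)) : Finset α) : Set α) := by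
    ext; simp
  rw [h1, h2, Set.ncard_coe_finset, Set.ncard_coe_finset,
    ← Finset.sum_filter_add_sum_filter_not hS.toFinset (fun p => Even (c p))]
  rw [Finset.sum_congr rfl (g := fun _ => (1 : ℤ)) (s₂ := hS.toFinset.filter (fun p => Even (c p)))
      (fun p hp => (Finset.mem_filter.1 hp).2.neg_one_pow),
    Finset.sum_congr rfl (g := fun _ => (-1 : ℤ)) (s₂ := hS.toFinset.filter (fun p => ¬ Even (c p)))
      (fun p hp => (Nat.not_even_iff_odd.1 (Finset.mem_filter.1 hp).2).neg_one_pow)]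
  simp [sub_eq_add_neg]

lemma fin_parts (n : ℕ) : {m : Multiset ℕ | (∀ x ∈ m, 0 < x) ∧ m.sum ≤ n}.Finite := by
  have : {m : Multiset ℕ | (∀ x ∈ m, 0 < x) ∧ m.sum ≤ n} ⊆
      ⋃ k ∈ Set.Iic n, Set.range (fun p : Nat.Partition k => p.parts) := by
    rintro m ⟨h1, h2⟩
    simp only [Set.mem_iUnion]
    exact ⟨m.sum, h2, ⟨m, fun {i} hi => h1 i hi, rfl⟩, rfl⟩
  refine Set.Finite.subset ?_ this
  exact (Set.finite_Iic n).biUnion fun k _ => Set.finite_range _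

lemma GSet_finite (n : ℕ) : (GSet n).Finite := by
  refine ((fin_parts n).prod (fin_parts n)).subset ?_
  rintro ⟨a, b⟩ ⟨h1, h2, h3, -⟩
  simp only at h3
  exact ⟨⟨h1, by simp only; omega⟩, ⟨h2, by simp only; omega⟩⟩

lemma KSet_finite (n : ℕ) : (KSet n).Finite := by
  refine Set.Finite.subset (Finset.finite_toSet (Finset.range (n + 1)).powerset) ?_
  rintro s ⟨h1, h2, -⟩
  simp only [Finset.coe_powerset, Set.mem_preimage, Set.mem_powerset_iff]
  intro x hx
  have := Finset.single_le_sum (f := id) (fun i _ => Nat.zero_le _) hx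
  simp only [id] at this h2
  simp
  omega

open Classical in
def invG (p : Multiset ℕ × Multiset ℕ) : Multiset ℕ × Multiset ℕ :=
  if ∃ x, Cand 1 p.1 x then (inv 1 p.1, p.2) else (p.1, inv 2 p.2)

def Good (p : Multiset ℕ × Multiset ℕ) : Prop :=
  (¬ ∃ x, Cand 1 p.1 x) ∧ ¬ ∃ x, Cand 2 p.2 x

lemma invG_spec {n : ℕ} {p : Multiset ℕ × Multiset ℕ} (hp : p ∈ GSet n) (hg : ¬ Good p) :
    invG p ∈ GSet n ∧ ¬ Good (invG p) ∧ invG (invG p) = p ∧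
      (-1 : ℤ) ^ ((invG p).1 + (invG p).2).card = - (-1) ^ (p.1 + p.2).card := by
  obtain ⟨a, b⟩ := p
  obtain ⟨h1, h2, h3, h4⟩ := hp
  simp only at h1 h2 h3 h4
  simp only [even_iff_two_dvd] at h4
  by_cases ha : ∃ x, Cand 1 a x
  · obtain ⟨k1, k2, k3, k4, k5, k6⟩ := inv_spec ha
    have e : invG (a, b) = (inv 1 a, b) := by simp only [invG, if_pos ha]
    rw [e]
    refine ⟨⟨k5 h1, h2, by simp only [k3, h3], ?_⟩, fun h => h.1 k2, ?_, ?_⟩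
    · simpa only [even_iff_two_dvd] using h4
    · simp only [invG, if_pos k2, k1]
    · simp only [Multiset.card_add, pow_add, k4]
      ring
  · have hb : ∃ x, Cand 2 b x := by
      by_contra hb
      exact hg ⟨ha, hb⟩
    obtain ⟨k1, k2, k3, k4, k5, k6⟩ := inv_spec hb
    have e : invG (a, b) = (a, inv 2 b) := by simp only [invG, if_neg ha]
    rw [e]
    refine ⟨⟨h1, k5 h2, by simp only [k3, h3], ?_⟩, fun h => h.2 k2, ?_, ?_⟩
    · simpa only [even_iff_two_dvd] using k6 h4
    · simp only [invG, if_neg ha, k1]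
    · simp only [Multiset.card_add, pow_add, k4]
      ring

open Classical in
lemma sum_good (n : ℕ) :
    ∑ p ∈ (GSet_finite n).toFinset, (-1 : ℤ) ^ (p.1 + p.2).card =
      ∑ p ∈ (GSet_finite n).toFinset.filter Good, (-1 : ℤ) ^ (p.1 + p.2).card := by
  rw [← Finset.sum_filter_add_sum_filter_not _ Good, add_eq_left]
  refine Finset.sum_involution (fun p _ => invG p) ?_ ?_ ?_ ?_
  · intro p hp
    simp only [Finset.mem_filter, Set.Finite.mem_toFinset] at hp
    rw [(invG_spec hp.1 hp.2).2.2.2]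
    ring
  · intro p hp h0 he
    simp only [Finset.mem_filter, Set.Finite.mem_toFinset] at hp
    have := (invG_spec hp.1 hp.2).2.2.2
    rw [he] at this
    exact h0 (by linarith)
  · intro p hp
    simp only [Finset.mem_filter, Set.Finite.mem_toFinset] at hp ⊢
    exact ⟨(invG_spec hp.1 hp.2).1, (invG_spec hp.1 hp.2).2.1⟩
  · intro p hp
    simp only [Finset.mem_filter, Set.Finite.mem_toFinset] at hp
    exact (invG_spec hp.1 hp.2).2.2.1

lemma not_cand {d : ℕ} {m : Multiset ℕ} (hm : ∀ x ∈ m, 0 < x) (hd : ∀ x ∈ m, d ∣ x) :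
    (¬ ∃ x, Cand d m x) ↔ m.Nodup ∧ ∀ x ∈ m, ¬ 2 * d ∣ x := by
  constructor
  · intro h
    refine ⟨Multiset.nodup_iff_count_le_one.2 fun x => ?_, fun x hx hdx => ?_⟩
    · by_contra hc
      have hx : x ∈ m := Multiset.count_pos.1 (by omega)
      exact h ⟨x, hm x hx, hd x hx, Or.inr (by omega)⟩
    · obtain ⟨k, rfl⟩ := hdx
      have := hm _ hx
      refine h ⟨d * k, ?_, dvd_mul_right _ _, Or.inl (by rwa [← mul_assoc])⟩
      rw [mul_assoc] at this
      omega
  · rintro ⟨h1, h2⟩ ⟨x, hx, hdx, h | h⟩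
    · exact h2 _ h (mul_dvd_mul_left 2 hdx)
    · have := Multiset.nodup_iff_count_le_one.1 h1 x
      omega

lemma sign_odd (s : Finset ℕ) :
    (-1 : ℤ) ^ (s.sum id) = (-1) ^ (s.filter (fun x => ¬ Even x)).card := by
  rw [← Finset.prod_pow_eq_pow_sum, ← Finset.prod_filter_mul_prod_filter_not s (fun x => Even x),
    Finset.prod_eq_one, one_mul, Finset.card_eq_sum_ones, ← Finset.prod_pow_eq_pow_sum]
  · refine Finset.prod_congr rfl fun x hx => ?_
    rw [pow_one]
    exact (Nat.not_even_iff_odd.1 (Finset.mem_filter.1 hx).2).neg_one_pow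
  · intro x hx
    exact (Finset.mem_filter.1 hx).2.neg_one_pow

/-- `G₄(n) - G₅(n) = (-1)^n * K(n)`. -/
theorem G4_sub_G5 (n : ℕ) : (G4 n : ℤ) - (G5 n : ℤ) = (-1) ^ n * Kcount n := by
  classical
  unfold G4 G5 Kcount
  rw [ncard_sub (GSet_finite n) (fun p => Multiset.card (p.1 + p.2)), sum_good,
    ncard_sub (KSet_finite n) (fun s => (s.filter (fun x => Even x)).card), Finset.mul_sum]
  symm
  refine Finset.sum_bij (fun s _ => ((s.filter (fun x => ¬ Even x)).val,
    (s.filter (fun x => Even x)).val)) ?_ ?_ ?_ ?_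
  · intro s hs
    simp only [Finset.mem_filter, Set.Finite.mem_toFinset] at hs ⊢
    obtain ⟨h1, h2, h3⟩ := hs
    have p1 : ∀ x ∈ (s.filter (fun x => ¬ Even x)).val, 0 < x := fun x hx =>
      h1 x (Finset.mem_filter.1 hx).1
    have p2 : ∀ x ∈ (s.filter (fun x => Even x)).val, 0 < x := fun x hx =>
      h1 x (Finset.mem_filter.1 hx).1
    have p3 : ∀ x ∈ (s.filter (fun x => Even x)).val, Even x := fun x hx =>
      (Finset.mem_filter.1 hx).2
    refine ⟨⟨p1, p2, ?_, p3⟩, (not_cand p1 (by simp)).2 ⟨Finset.nodup _, ?_⟩,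
      (not_cand p2 (fun x hx => (p3 x hx).two_dvd)).2 ⟨Finset.nodup _, ?_⟩⟩
    · rw [← h2, ← Finset.sum_filter_not_add_sum_filter s (fun x => Even x)]
      simp [Finset.sum]
    · intro x hx h
      exact (Finset.mem_filter.1 hx).2 (even_iff_two_dvd.2 (by simpa using h))
    · intro x hx h
      have := h3 x (Finset.mem_filter.1 hx).1 (p3 x hx)
      omega
  · intro s _ t _ h
    simp only [Prod.mk.injEq, Finset.val_inj] at h
    rw [← Finset.filter_union_filter_not_eq (fun x => Even x) s, h.1, h.2,
      Finset.filter_union_filter_not_eq]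
  · rintro ⟨a, b⟩ hab
    simp only [Finset.mem_filter, Set.Finite.mem_toFinset] at hab
    obtain ⟨⟨h1, h2, h3, h4⟩, h5, h6⟩ := hab
    simp only at h1 h2 h3 h4 h5 h6
    rw [not_cand h1 (by simp)] at h5
    rw [not_cand h2 (fun x hx => (h4 x hx).two_dvd)] at h6
    obtain ⟨na, oa⟩ := h5
    obtain ⟨nb, ob⟩ := h6
    have oa' : ∀ x ∈ a, ¬ Even x := fun x hx h => oa x hx (by simpa using h.two_dvd)
    have hdis : Disjoint (⟨a, na⟩ : Finset ℕ) ⟨b, nb⟩ := by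
      rw [Finset.disjoint_left]
      intro x hx hx'
      exact oa' x hx (h4 x hx')
    refine ⟨(⟨a, na⟩ : Finset ℕ) ∪ ⟨b, nb⟩, ?_, ?_⟩
    · simp only [Set.Finite.mem_toFinset]
      refine ⟨?_, ?_, ?_⟩
      · intro x hx
        rcases Finset.mem_union.1 hx with hx | hx
        · exact h1 x hx
        · exact h2 x hx
      · rw [Finset.sum_union hdis, ← h3]
        simp [Finset.sum]
      · intro x hx he
        rcases Finset.mem_union.1 hx with hx | hx
        · exact absurd he (oa' x hx)
        · have := ob x hx
          obtain ⟨k, rfl⟩ := he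
          omega
    · have e1 : ((⟨a, na⟩ : Finset ℕ) ∪ ⟨b, nb⟩).filter (fun x => ¬ Even x) = ⟨a, na⟩ := by
        ext x
        simp only [Finset.mem_filter, Finset.mem_union, Finset.mem_mk]
        exact ⟨fun h => h.1.resolve_right fun hb => h.2 (h4 x hb), fun h => ⟨Or.inl h, oa' x h⟩⟩
      have e2 : ((⟨a, na⟩ : Finset ℕ) ∪ ⟨b, nb⟩).filter (fun x => Even x) = ⟨b, nb⟩ := by
        ext x
        simp only [Finset.mem_filter, Finset.mem_union, Finset.mem_mk]
        exact ⟨fun h => h.1.resolve_left fun ha => oa' x ha h.2, fun h => ⟨Or.inr h, h4 x h⟩⟩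
      rw [e1, e2]
  · intro s hs
    simp only [Set.Finite.mem_toFinset] at hs
    rw [← hs.2.1, sign_odd, ← pow_add]
    simp only [Multiset.card_add, Finset.card_val]
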